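/- Let m, k ≥ 1 and let H=(V,E) be the m-fold 2k-cycle. For every edge-dominated E-polymatroid h on V, at least one of the following holds: (i) there exists i0 ∈ [2k] such that h(I_{i0} ∪ I_i ∪ I_{i+1}) ≤ m(2 − 1/k) for every i ∈ [2k] with i0 ∉ {i, i+1} (indices cyclic); or (ii) both h(I_1 ∪ I_2 ∪ ⋯ ∪ I_{k+1}) ≤ m(2 − 1/k) and h(I_{k+1} ∪ I_{k+2} ∪ ⋯ ∪ I_{2k} ∪ I_1) ≤ m(2 − 1/k). (Since the two alternatives correspond to the bags of two tree decompositions of H, this establishes that the #-submodular width of the m-fold 2k-cycle is at most m(2 − 1/k).) -/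

import Mathlib

/-- Vertices of the `m`-fold `2k`-cycle: pairs `(i, j)` with `i` a cyclic group index and
`j ∈ [m]`; the vertex `(i, j)` is `I_i^j`. -/
abbrev CycVtx (m k : ℕ) := ZMod (2 * k) × Fin m

/-- The vertex group `I_i`. -/
def cycGroup (m k : ℕ) (i : ZMod (2 * k)) : Finset (CycVtx m k) :=
  Finset.univ.image (fun j : Fin m => (i, j))

/-- The edges of the `m`-fold `2k`-cycle. -/
def cycEdges (m k : ℕ) : Set (Finset (CycVtx m k)) :=
  { e | ∃ (i : ZMod (2 * k)) (j j' : Fin m), e = {(i, j), (i + 1, j')} }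

/-- An `E`-polymatroid (with `E` a collection of subsets of `V`). -/
def IsEPolymatroid {V : Type} [DecidableEq V]
    (E : Set (Finset V)) (h : Finset V → ℝ) : Prop :=
  (∀ S : Finset V, 0 ≤ h S) ∧ h ∅ = 0 ∧
    (∀ X Y : Finset V, X ⊆ Y → h X ≤ h Y) ∧
    (∀ X Y : Finset V, (∃ S ∈ E, X ∩ Y ⊆ S) → h (X ∪ Y) + h (X ∩ Y) ≤ h X + h Y)

/-- Edge-dominated: at most `1` on every edge. -/
def EdgeDominated {V : Type} [DecidableEq V]
    (E : Set (Finset V)) (h : Finset V → ℝ) : Prop :=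
  ∀ S ∈ E, h S ≤ 1

/-- An `E`-polymatroid on the `m`-fold cycle is subadditive over sets lying in distinct layers. -/
theorem IsEPolymatroid.biUnion_layers_le {m k : ℕ} (hm : 1 ≤ m)
    {h : Finset (CycVtx m k) → ℝ} (hEP : IsEPolymatroid (cycEdges m k) h)
    (f : Fin m → Finset (CycVtx m k)) (hf : ∀ j, ∀ v ∈ f j, v.2 = j) (s : Finset (Fin m)) :
    h (s.biUnion f) ≤ ∑ j ∈ s, h (f j) := by
  induction s using Finset.induction_on with
  | empty => simp [hEP.2.1]
  | insert a s ha ih =>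
    rw [Finset.biUnion_insert, Finset.sum_insert ha]
    have hdisj : f a ∩ s.biUnion f = ∅ := by
      refine Finset.eq_empty_of_forall_notMem fun v hv => ?_
      obtain ⟨hva, hvs⟩ := Finset.mem_inter.mp hv
      obtain ⟨b, hb, hvb⟩ := Finset.mem_biUnion.mp hvs
      exact ha ((hf a v hva).symm.trans (hf b v hvb) ▸ hb)
    have hsub := hEP.2.2.2 (f a) (s.biUnion f)
      ⟨_, ⟨0, ⟨0, hm⟩, ⟨0, hm⟩, rfl⟩, by rw [hdisj]; exact Finset.empty_subset _⟩
    rw [hdisj, hEP.2.1] at hsub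
    linarith

/-- The path through the `j`-th vertices of the groups `I_a, …, I_{a+n}`. -/
def cycPath (m k a n : ℕ) (j : Fin m) : Finset (CycVtx m k) :=
  (Finset.range (n + 1)).image fun t => (((a + t : ℕ) : ZMod (2 * k)), j)

/-- The value of a path plus the values of its interior vertices is at most its length. -/
theorem IsEPolymatroid.cycPath_add_sum_le {m k : ℕ}
    {h : Finset (CycVtx m k) → ℝ} (hEP : IsEPolymatroid (cycEdges m k) h)
    (hED : EdgeDominated (cycEdges m k) h) (a n : ℕ) (j : Fin m) :
    h (cycPath m k a (n + 1) j) +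
      ∑ t ∈ Finset.range n, h {(((a + t + 1 : ℕ) : ZMod (2 * k)), j)} ≤ n + 1 := by
  induction n with
  | zero =>
    have := hED (cycPath m k a 1 j) ⟨(a : ZMod (2 * k)), j, j, by
      ext v; simp [cycPath, Finset.range_add_one, or_comm]⟩
    simpa using this
  | succ n ih =>
    set e : Finset (CycVtx m k) :=
      {(((a + n + 1 : ℕ) : ZMod (2 * k)), j), (((a + n + 1 : ℕ) : ZMod (2 * k)) + 1, j)} with he
    have hmem : e ∈ cycEdges m k := ⟨_, j, j, rfl⟩
    have hsub := hEP.2.2.2 (cycPath m k a (n + 1) j) e ⟨e, hmem, Finset.inter_subset_right⟩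
    have hunion : cycPath m k a (n + 1 + 1) j ⊆ cycPath m k a (n + 1) j ∪ e := by
      intro v hv
      obtain ⟨t, ht, rfl⟩ := Finset.mem_image.mp hv
      rcases (Nat.lt_succ_iff_lt_or_eq).mp (Finset.mem_range.mp ht) with hlt | rfl
      · exact Finset.mem_union_left _
          (Finset.mem_image.mpr ⟨t, Finset.mem_range.mpr hlt, rfl⟩)
      · refine Finset.mem_union_right _ ?_
        simp [he, add_assoc, one_add_one_eq_two]
    have hinter : {(((a + n + 1 : ℕ) : ZMod (2 * k)), j)} ⊆ cycPath m k a (n + 1) j ∩ e := by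
      refine Finset.singleton_subset_iff.mpr (Finset.mem_inter.mpr ⟨?_, by simp [he]⟩)
      exact Finset.mem_image.mpr ⟨n + 1, by simp, rfl⟩
    have h1 := hEP.2.2.1 _ _ hunion
    have h2 := hEP.2.2.1 _ _ hinter
    have h3 := hED e hmem
    rw [Finset.sum_range_succ]
    push_cast at *
    linarith

/-- A vertex group has value at most the sum of the values of its vertices. -/
theorem IsEPolymatroid.cycGroup_le_sum {m k : ℕ} (hm : 1 ≤ m)
    {h : Finset (CycVtx m k) → ℝ} (hEP : IsEPolymatroid (cycEdges m k) h) (i : ZMod (2 * k)) :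
    h (cycGroup m k i) ≤ ∑ j, h {(i, j)} := by
  have := hEP.biUnion_layers_le hm (fun j => {(i, j)}) (by simp) Finset.univ
  rwa [Finset.biUnion_singleton] at this

/-- Two consecutive vertex groups together have value at most `m`. -/
theorem IsEPolymatroid.cycGroup_union_succ_le {m k : ℕ} (hm : 1 ≤ m)
    {h : Finset (CycVtx m k) → ℝ} (hEP : IsEPolymatroid (cycEdges m k) h)
    (hED : EdgeDominated (cycEdges m k) h) (i : ZMod (2 * k)) :
    h (cycGroup m k i ∪ cycGroup m k (i + 1)) ≤ m := by
  have hle := hEP.biUnion_layers_le hm (fun j => {(i, j), (i + 1, j)})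
    (by simp) Finset.univ
  have hsum : ∑ j : Fin m, h {(i, j), (i + 1, j)} ≤ ∑ _j : Fin m, (1 : ℝ) :=
    Finset.sum_le_sum fun j _ => hED _ ⟨i, j, j, rfl⟩
  have heq : cycGroup m k i ∪ cycGroup m k (i + 1) =
      Finset.univ.biUnion fun j : Fin m => ({(i, j), (i + 1, j)} : Finset (CycVtx m k)) := by
    ext v
    simp only [cycGroup, Finset.mem_union, Finset.mem_image, Finset.mem_biUnion,
      Finset.mem_univ, true_and, Finset.mem_insert, Finset.mem_singleton, ← exists_or, eq_comm]
  rw [heq]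
  simpa using hle.trans hsum

/-- If every vertex group has value at least `m(1 - 1/k)`, then `k + 1` consecutive groups
together have value at most `m(2 - 1/k)`. -/
theorem IsEPolymatroid.biUnion_cycGroup_le {m k : ℕ} (hm : 1 ≤ m) (hk : 1 ≤ k)
    {h : Finset (CycVtx m k) → ℝ} (hEP : IsEPolymatroid (cycEdges m k) h)
    (hED : EdgeDominated (cycEdges m k) h)
    (hheavy : ∀ i, (m : ℝ) * (1 - 1 / (k : ℝ)) ≤ h (cycGroup m k i)) (a : ℕ) :
    h ((Finset.Icc a (a + k)).biUnion fun i : ℕ => cycGroup m k (i : ZMod (2 * k)))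
      ≤ (m : ℝ) * (2 - 1 / (k : ℝ)) := by
  obtain ⟨n, rfl⟩ := Nat.exists_eq_add_of_le' hk
  have hcover : ((Finset.Icc a (a + (n + 1))).biUnion
      fun i : ℕ => cycGroup m (n + 1) (i : ZMod (2 * (n + 1)))) ⊆
      Finset.univ.biUnion (cycPath m (n + 1) a (n + 1)) := by
    intro v hv
    obtain ⟨i, hi, hvi⟩ := Finset.mem_biUnion.mp hv
    obtain ⟨j, -, rfl⟩ := Finset.mem_image.mp hvi
    obtain ⟨hai, hia⟩ := Finset.mem_Icc.mp hi
    refine Finset.mem_biUnion.mpr ⟨j, Finset.mem_univ j, Finset.mem_image.mpr ⟨i - a, ?_, ?_⟩⟩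
    · exact Finset.mem_range.mpr (by omega)
    · rw [Nat.add_sub_cancel' hai]
  have hmono := hEP.2.2.1 _ _ hcover
  have hlayers := hEP.biUnion_layers_le hm (cycPath m (n + 1) a (n + 1)) (fun j v hv => by
    obtain ⟨t, -, rfl⟩ := Finset.mem_image.mp hv
    rfl) Finset.univ
  have hpaths := Finset.sum_le_sum fun j (_ : j ∈ (Finset.univ : Finset (Fin m))) =>
    hEP.cycPath_add_sum_le hED a n j
  rw [Finset.sum_add_distrib, Finset.sum_comm] at hpaths
  have hinterior := Finset.sum_le_sum fun t (_ : t ∈ Finset.range n) =>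
    (hheavy ((a + t + 1 : ℕ) : ZMod (2 * (n + 1)))).trans (hEP.cycGroup_le_sum hm _)
  simp only [Finset.sum_const, Finset.card_univ, Fintype.card_fin, Finset.card_range,
    nsmul_eq_mul] at hpaths hinterior
  have hn : ((n + 1 : ℕ) : ℝ) ≠ 0 := by positivity
  have hcount : (m : ℝ) * (n + 1) - n * (m * (1 - 1 / ((n + 1 : ℕ) : ℝ))) =
      m * (2 - 1 / ((n + 1 : ℕ) : ℝ)) := by
    push_cast at hn ⊢
    field_simp
    ring
  linarith

/-- For every edge-dominated `E`-polymatroid on the `m`-fold `2k`-cycle, either some group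
`I_{i0}` gives bags `I_{i0} ∪ I_i ∪ I_{i+1}` all of value at most `m(2 − 1/k)`, or both halves
`I_1 ∪ ⋯ ∪ I_{k+1}` and `I_{k+1} ∪ ⋯ ∪ I_{2k} ∪ I_1` have value at most `m(2 − 1/k)`
(so `#subw` of the `m`-fold `2k`-cycle is at most `m(2 − 1/k)`). -/
theorem mfold_cycle_sharp_submodular_width_bound
    (m k : ℕ) (hm : 1 ≤ m) (hk : 1 ≤ k)
    (h : Finset (CycVtx m k) → ℝ)
    (hEP : IsEPolymatroid (cycEdges m k) h) (hED : EdgeDominated (cycEdges m k) h) :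
    (∃ i0 : ZMod (2 * k), ∀ i : ZMod (2 * k), i0 ≠ i → i0 ≠ i + 1 →
        h (cycGroup m k i0 ∪ cycGroup m k i ∪ cycGroup m k (i + 1))
          ≤ (m : ℝ) * (2 - 1 / (k : ℝ))) ∨
    (h ((Finset.Icc 1 (k + 1)).biUnion (fun i : ℕ => cycGroup m k (i : ZMod (2 * k))))
        ≤ (m : ℝ) * (2 - 1 / (k : ℝ)) ∧
      h ((Finset.Icc (k + 1) (2 * k + 1)).biUnion
          (fun i : ℕ => cycGroup m k (i : ZMod (2 * k))))
        ≤ (m : ℝ) * (2 - 1 / (k : ℝ))) := by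
  by_cases hlight : ∃ i0, h (cycGroup m k i0) ≤ (m : ℝ) * (1 - 1 / (k : ℝ))
  · obtain ⟨i0, hi0⟩ := hlight
    refine Or.inl ⟨i0, fun i hne hne' => ?_⟩
    have hdisj : cycGroup m k i0 ∩ (cycGroup m k i ∪ cycGroup m k (i + 1)) = ∅ := by
      refine Finset.eq_empty_of_forall_notMem fun v hv => ?_
      simp only [cycGroup, Finset.mem_inter, Finset.mem_union, Finset.mem_image,
        Finset.mem_univ, true_and] at hv
      obtain ⟨⟨j, rfl⟩, ⟨j', hj'⟩ | ⟨j', hj'⟩⟩ := hv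
      · exact hne (congrArg Prod.fst hj').symm
      · exact hne' (congrArg Prod.fst hj').symm
    have hsub := hEP.2.2.2 (cycGroup m k i0) (cycGroup m k i ∪ cycGroup m k (i + 1))
      ⟨_, ⟨0, ⟨0, hm⟩, ⟨0, hm⟩, rfl⟩, by rw [hdisj]; exact Finset.empty_subset _⟩
    rw [hdisj, hEP.2.1] at hsub
    have hpair := hEP.cycGroup_union_succ_le hm hED i
    rw [Finset.union_assoc]
    linarith
  · push Not at hlight
    have hheavy := fun i => (hlight i).le
    refine Or.inr ⟨?_, ?_⟩
    · rw [add_comm k 1]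
      exact hEP.biUnion_cycGroup_le hm hk hED hheavy 1
    · rw [show 2 * k + 1 = k + 1 + k by ring]
      exact hEP.biUnion_cycGroup_le hm hk hED hheavy (k + 1)
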